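/- arXiv:2102.00705 — 4 statements merged into one kernel-verified Lean document; each statement's English description precedes it below -/
import Mathlib

section
/- Fix ε > 0, φ ∈ ℝ, N ∈ ℕ and q ∈ ℝ^N, and set a := (1/(4ε))·(φ² − 1)² + (ε/2)·|q|². Let e, s, p : (0,∞) × (0,∞) → ℝ be twice continuously differentiable functions of (ρ, θ), and define E(ρ,θ) := e(ρ,θ) + a/ρ. Assume that for all ρ > 0 and θ > 0: ∂s/∂θ(ρ,θ) = (1/θ)·∂E/∂θ(ρ,θ) and ∂s/∂ρ(ρ,θ) = (1/θ)·(∂E/∂ρ(ρ,θ) − p(ρ,θ)/ρ²). Then for all ρ > 0 and θ > 0: p(ρ,θ) = ρ²·∂e/∂ρ(ρ,θ) − (1/(4ε))·(φ² − 1)² − (ε/2)·|q|² + θ·∂p/∂θ(ρ,θ). -/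
open Set

open Filter Topology

/-- Partial derivatives of a function of two real variables, from its differential. -/
lemma HasFDerivAt.hasDerivAt_fst {F : ℝ × ℝ → ℝ} {L : ℝ × ℝ →L[ℝ] ℝ} {x y : ℝ}
    (h : HasFDerivAt F L (x, y)) : HasDerivAt (fun r => F (r, y)) (L (1, 0)) x :=
  h.comp_hasDerivAt x ((hasDerivAt_id x).prodMk (hasDerivAt_const x y))

lemma HasFDerivAt.hasDerivAt_snd {F : ℝ × ℝ → ℝ} {L : ℝ × ℝ →L[ℝ] ℝ} {x y : ℝ}
    (h : HasFDerivAt F L (x, y)) : HasDerivAt (fun t => F (x, t)) (L (0, 1)) y :=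
  h.comp_hasDerivAt y ((hasDerivAt_const y x).prodMk (hasDerivAt_id y))

/-- Schwarz's theorem for iterated partial derivatives of a function of two real variables. -/
lemma ContDiffAt.exists_hasDerivAt_mixed_partials {F : ℝ × ℝ → ℝ} {x y : ℝ}
    (hF : ContDiffAt ℝ 2 F (x, y)) :
    ∃ m, HasDerivAt (fun r => deriv (fun t => F (r, t)) y) m x ∧
      HasDerivAt (fun t => deriv (fun r => F (r, t)) x) m y := by
  have hsymm : IsSymmSndFDerivAt ℝ F (x, y) := hF.isSymmSndFDerivAt (by simp)
  have hdiff : ∀ᶠ z in 𝓝 (x, y), DifferentiableAt ℝ F z :=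
    (hF.eventually (by simp)).mono fun z hz => hz.differentiableAt (by simp)
  have h2 : HasFDerivAt (fderiv ℝ F) (fderiv ℝ (fderiv ℝ F) (x, y)) (x, y) :=
    ((hF.fderiv_right (m := 1) (by norm_num)).differentiableAt (by simp)).hasFDerivAt
  have happ (v : ℝ × ℝ) := h2.clm_apply (hasFDerivAt_const v (x, y))
  have hx : Tendsto (fun r : ℝ => (r, y)) (𝓝 x) (𝓝 (x, y)) :=
    (Continuous.prodMk_left y).tendsto x
  have hy : Tendsto (fun t : ℝ => (x, t)) (𝓝 y) (𝓝 (x, y)) :=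
    (Continuous.prodMk_right x).tendsto y
  refine ⟨fderiv ℝ (fderiv ℝ F) (x, y) (1, 0) (0, 1), ?_, ?_⟩
  · have h := (happ (0, 1)).hasDerivAt_fst
    simp only [add_apply, ContinuousLinearMap.comp_apply,
      ContinuousLinearMap.flip_apply, zero_apply, map_zero, zero_add] at h
    exact h.congr_of_eventuallyEq
      ((hx.eventually hdiff).mono fun r hr => hr.hasFDerivAt.hasDerivAt_snd.deriv)
  · have h := (happ (1, 0)).hasDerivAt_snd
    simp only [add_apply, ContinuousLinearMap.comp_apply,
      ContinuousLinearMap.flip_apply, zero_apply, map_zero, zero_add] at h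
    rw [hsymm (1, 0) (0, 1)]
    exact h.congr_of_eventuallyEq
      ((hy.eventually hdiff).mono fun t ht => ht.hasFDerivAt.hasDerivAt_fst.deriv)

/-- Explicit pressure formula for the interfacial free energy density
`f(ρ,φ,∇φ) = (1/(4ερ))(1−φ²)² + (ε/(2ρ))|∇φ|²`:
`p = ρ²·∂e/∂ρ − (1/(4ε))(φ²−1)² − (ε/2)|∇φ|² + θ·∂p/∂θ`. -/
theorem pressure_formula
    (ε : ℝ) (hε : 0 < ε) (φ : ℝ) (N : ℕ) (q : EuclideanSpace ℝ (Fin N))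
    (a : ℝ) (ha : a = (1 / (4 * ε)) * (φ ^ 2 - 1) ^ 2 + (ε / 2) * ‖q‖ ^ 2)
    (e s p : ℝ → ℝ → ℝ)
    (he : ContDiffOn ℝ 2 (fun x : ℝ × ℝ => e x.1 x.2) (Ioi 0 ×ˢ Ioi 0))
    (hs : ContDiffOn ℝ 2 (fun x : ℝ × ℝ => s x.1 x.2) (Ioi 0 ×ˢ Ioi 0))
    (hp : ContDiffOn ℝ 2 (fun x : ℝ × ℝ => p x.1 x.2) (Ioi 0 ×ˢ Ioi 0))
    (E : ℝ → ℝ → ℝ) (hE : ∀ ρ θ : ℝ, E ρ θ = e ρ θ + a / ρ)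
    (h1 : ∀ ρ θ : ℝ, 0 < ρ → 0 < θ →
      deriv (fun t => s ρ t) θ = (1 / θ) * deriv (fun t => E ρ t) θ)
    (h2 : ∀ ρ θ : ℝ, 0 < ρ → 0 < θ →
      deriv (fun r => s r θ) ρ
        = (1 / θ) * (deriv (fun r => E r θ) ρ - p ρ θ / ρ ^ 2)) :
    ∀ ρ θ : ℝ, 0 < ρ → 0 < θ →
      p ρ θ = ρ ^ 2 * deriv (fun r => e r θ) ρ
        - (1 / (4 * ε)) * (φ ^ 2 - 1) ^ 2 - (ε / 2) * ‖q‖ ^ 2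
        + θ * deriv (fun t => p ρ t) θ := by
  intro ρ θ hρ hθ
  have hnhds {r t : ℝ} (hr : 0 < r) (ht : 0 < t) : Ioi (0 : ℝ) ×ˢ Ioi (0 : ℝ) ∈ 𝓝 (r, t) :=
    prod_mem_nhds (Ioi_mem_nhds hr) (Ioi_mem_nhds ht)
  obtain ⟨ms, hs₁, hs₂⟩ :=
    (hs.contDiffAt (hnhds hρ hθ)).exists_hasDerivAt_mixed_partials
  obtain ⟨me, he₁, he₂⟩ :=
    (he.contDiffAt (hnhds hρ hθ)).exists_hasDerivAt_mixed_partials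
  have hpθ : HasDerivAt (fun t => p ρ t) (deriv (fun t => p ρ t) θ) θ :=
    ((hp.contDiffAt (hnhds hρ hθ)).differentiableAt
      (by simp)).hasFDerivAt.hasDerivAt_snd.differentiableAt.hasDerivAt
  have hEρ {t : ℝ} (ht : 0 < t) :
      deriv (fun r => E r t) ρ = deriv (fun r => e r t) ρ - a / ρ ^ 2 := by
    have hder : HasDerivAt (fun r => e r t) (deriv (fun r => e r t) ρ) ρ :=
      ((he.contDiffAt (hnhds hρ ht)).differentiableAt
        (by simp)).hasFDerivAt.hasDerivAt_fst.differentiableAt.hasDerivAt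
    simp only [hE]
    refine (hder.add ((hasDerivAt_inv hρ.ne').const_mul a)).deriv.trans ?_
    ring
  have hms₁ : ms = 1 / θ * me := by
    refine hs₁.unique ((he₁.const_mul (1 / θ)).congr_of_eventuallyEq ?_)
    filter_upwards [Ioi_mem_nhds hρ] with r hr
    simpa [hE] using h1 r θ hr hθ
  have hms₂ : ms = -(θ ^ 2)⁻¹ * (deriv (fun r => e r θ) ρ - a / ρ ^ 2 - p ρ θ / ρ ^ 2)
      + θ⁻¹ * (me - deriv (fun t => p ρ t) θ / ρ ^ 2) := by
    refine hs₂.unique (((hasDerivAt_inv hθ.ne').mul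
      ((he₂.sub_const (a / ρ ^ 2)).sub (hpθ.div_const (ρ ^ 2)))).congr_of_eventuallyEq ?_)
    filter_upwards [Ioi_mem_nhds hθ] with t ht
    simpa [hEρ ht] using h2 ρ t hρ ht
  rw [hms₁] at hms₂
  field_simp at hms₂
  linear_combination -hms₂ - ha
end

section
/- Let λ, ν ∈ ℝ with λ + 2ν > 0, let ρ : ℝ → ℝ be continuously differentiable with ρ(ξ) > 0 for all ξ, let u : ℝ → ℝ be continuous, let V ∈ ℝ, and let c ∈ ℝ be such that ρ(ξ)(V − u(ξ)) = c for all ξ ∈ ℝ. Set w(ξ) := (V − u(ξ))·2(λ+2ν)·ρ(ξ)^{−4}·ρ'(ξ)². If w is integrable on ℝ and ∫_{−∞}^{+∞} w(ξ) dξ = 0, then ρ'(ξ)·(V − u(ξ)) = 0 for all ξ ∈ ℝ. -/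
open MeasureTheory

/-- A continuous nonnegative integrable function with vanishing integral vanishes everywhere. -/
theorem Continuous.eq_zero_of_integral_eq_zero {X : Type*} [TopologicalSpace X]
    [MeasurableSpace X] {μ : Measure X} [μ.IsOpenPosMeasure] {f : X → ℝ} (hf : Continuous f)
    (hnonneg : 0 ≤ f) (hint : Integrable f μ) (hzero : ∫ x, f x ∂μ = 0) : f = 0 :=
  (hf.ae_eq_iff_eq μ continuous_zero).1 ((integral_eq_zero_iff_of_nonneg hnonneg hint).1 hzero)

/-- Case (C2) `M_ε = 1/ε` of Lemma 2.2: vanishing of the integral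
`∫ (V − u)·2(λ+2ν)ρ⁻⁴|ρ'|² dξ`, together with constancy of the mass flux and
positivity of the density, forces `ρ'·(V − u) ≡ 0`. -/
theorem interface_velocity_C2
    (lam nu : ℝ) (hlamnu : 0 < lam + 2 * nu)
    (ρ : ℝ → ℝ) (hρ : ContDiff ℝ 1 ρ) (hρpos : ∀ ξ : ℝ, 0 < ρ ξ)
    (u : ℝ → ℝ) (hu : Continuous u)
    (V c : ℝ) (hflux : ∀ ξ : ℝ, ρ ξ * (V - u ξ) = c)
    (w : ℝ → ℝ)
    (hw : ∀ ξ : ℝ, w ξ = (V - u ξ) *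
      (2 * (lam + 2 * nu) * (ρ ξ ^ 4)⁻¹ * (deriv ρ ξ) ^ 2))
    (hint : MeasureTheory.Integrable w)
    (hzero : ∫ ξ : ℝ, w ξ = 0) :
    ∀ ξ : ℝ, deriv ρ ξ * (V - u ξ) = 0 := by
  have hw_cont : Continuous w := by
    have hderiv : Continuous (deriv ρ) := hρ.continuous_deriv le_rfl
    have hinv : Continuous fun ξ => (ρ ξ ^ 4)⁻¹ :=
      (hρ.continuous.pow 4).inv₀ fun ξ => (pow_pos (hρpos ξ) 4).ne'
    rw [funext hw]
    fun_prop
  have hcoef : ∀ ξ, 0 < ρ ξ * (2 * (lam + 2 * nu) * (ρ ξ ^ 4)⁻¹) := fun ξ => by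
    have := hρpos ξ
    positivity
  have hcw : ∀ ξ, c * w ξ =
      ρ ξ * (2 * (lam + 2 * nu) * (ρ ξ ^ 4)⁻¹) * (deriv ρ ξ * (V - u ξ)) ^ 2 := fun ξ => by
    rw [hw, ← hflux ξ]
    ring
  have hvanish : (fun ξ => c * w ξ) = 0 :=
    (hw_cont.const_mul c).eq_zero_of_integral_eq_zero
      (fun ξ => (mul_nonneg (hcoef ξ).le (sq_nonneg _)).trans_eq (hcw ξ).symm)
      (hint.const_mul c) (by rw [integral_const_mul, hzero, mul_zero])
  intro ξ
  have hξ := (hcw ξ).symm.trans (congrFun hvanish ξ)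
  exact pow_eq_zero_iff two_ne_zero |>.1 ((mul_eq_zero.1 hξ).resolve_left (hcoef ξ).ne')
end

section
/- Let N ∈ ℕ, let n ∈ ℝ^N, let κ ∈ ℝ, and let φ₀(ξ) = tanh(ξ/√2). Let p : ℝ → ℝ and r : ℝ → ℝ be differentiable with p(ξ) → p⁺ as ξ → +∞, p(ξ) → p⁻ as ξ → −∞, and r(ξ) → 0 as ξ → ±∞. Let G : ℝ → ℝ^N be differentiable with G(ξ) → G⁺ as ξ → +∞ and G(ξ) → G⁻ as ξ → −∞, and suppose that for all ξ ∈ ℝ: G'(ξ) = p'(ξ)·n + r'(ξ)·n + κ·φ₀'(ξ)²·n. Then G⁺ − G⁻ = (p⁺ − p⁻)·n + σ·κ·n, where σ = (2/3)√2. -/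
open Filter

theorem Real.hasDerivAt_tanh_one_sub_sq (x : ℝ) :
    HasDerivAt Real.tanh (1 - Real.tanh x ^ 2) x := by
  have hc : Real.cosh x ≠ 0 := (Real.cosh_pos x).ne'
  have h := (Real.hasDerivAt_sinh x).div (Real.hasDerivAt_cosh x) hc
  have he : Real.tanh = Real.sinh / Real.cosh := by
    funext y
    simp [Real.tanh_eq_sinh_div_cosh]
  rw [he]
  refine h.congr_deriv ?_
  simp only [Pi.div_apply]
  field_simp

theorem Real.tendsto_tanh_atTop_one : Tendsto Real.tanh atTop (nhds 1) := by
  have he : Real.tanh = fun x => (1 - Real.exp (-x) ^ 2) / (1 + Real.exp (-x) ^ 2) := by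
    funext x
    have hx : Real.exp x * Real.exp (-x) = 1 := by rw [← Real.exp_add]; simp
    rw [Real.tanh_eq, div_eq_div_iff (by positivity) (by positivity)]
    linear_combination (2 * Real.exp (-x)) * hx
  have h0 : Tendsto (fun x : ℝ => Real.exp (-x)) atTop (nhds 0) :=
    Real.tendsto_exp_neg_atTop_nhds_zero
  rw [he]
  have h := ((h0.pow 2).const_sub 1).div ((h0.pow 2).const_add 1) (by norm_num)
  norm_num at h
  exact h

theorem Real.tendsto_tanh_atBot_neg_one : Tendsto Real.tanh atBot (nhds (-1)) := by
  have h := (Real.tendsto_tanh_atTop_one.comp tendsto_neg_atBot_atTop).neg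
  refine h.congr fun x => ?_
  simp [Real.tanh_neg]

/-- An antiderivative of the squared derivative of the profile `tanh (ξ / √2)`. -/
theorem hasDerivAt_tanh_profile_energy (ξ : ℝ) :
    HasDerivAt (fun x => Real.sqrt 2 / 2 *
        (Real.tanh (x / Real.sqrt 2) - Real.tanh (x / Real.sqrt 2) ^ 3 / 3))
      (deriv (fun x => Real.tanh (x / Real.sqrt 2)) ξ ^ 2) ξ := by
  have h : HasDerivAt (fun x => Real.tanh (x / Real.sqrt 2))
      ((1 - Real.tanh (ξ / Real.sqrt 2) ^ 2) * (1 / Real.sqrt 2)) ξ :=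
    HasDerivAt.comp (h₂ := Real.tanh) (h := fun x => x / Real.sqrt 2) ξ
      (Real.hasDerivAt_tanh_one_sub_sq (ξ / Real.sqrt 2)) ((hasDerivAt_id ξ).div_const (Real.sqrt 2))
  rw [h.deriv]
  refine ((h.sub ((h.pow 3).div_const 3)).const_mul (Real.sqrt 2 / 2)).congr_deriv ?_
  have hs : Real.sqrt 2 ^ 2 = 2 := Real.sq_sqrt (by norm_num)
  field_simp
  rw [hs]
  ring

/-- Analytic core of Lemma 2.3 (stress jump condition): integrating the
first-order inner momentum balance over `ξ ∈ (−∞, ∞)` yields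
`[G] = [p]·n + σκn` with `σ = (2/3)√2`. -/
theorem stress_jump_condition
    (N : ℕ) (n : EuclideanSpace ℝ (Fin N)) (κ : ℝ)
    (φ₀ : ℝ → ℝ) (hφ₀ : ∀ ξ : ℝ, φ₀ ξ = Real.tanh (ξ / Real.sqrt 2))
    (p r : ℝ → ℝ) (hp : Differentiable ℝ p) (hr : Differentiable ℝ r)
    (pp pm : ℝ)
    (hpp : Tendsto p atTop (nhds pp)) (hpm : Tendsto p atBot (nhds pm))
    (hrtop : Tendsto r atTop (nhds 0)) (hrbot : Tendsto r atBot (nhds 0))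
    (G : ℝ → EuclideanSpace ℝ (Fin N)) (hG : Differentiable ℝ G)
    (Gp Gm : EuclideanSpace ℝ (Fin N))
    (hGp : Tendsto G atTop (nhds Gp)) (hGm : Tendsto G atBot (nhds Gm))
    (hODE : ∀ ξ : ℝ, deriv G ξ
      = deriv p ξ • n + deriv r ξ • n + (κ * (deriv φ₀ ξ) ^ 2) • n) :
    Gp - Gm = (pp - pm) • n + (((2 / 3) * Real.sqrt 2) * κ) • n := by
  obtain rfl : φ₀ = fun ξ => Real.tanh (ξ / Real.sqrt 2) := funext hφ₀
  let E : ℝ → ℝ := fun x => Real.sqrt 2 / 2 *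
    (Real.tanh (x / Real.sqrt 2) - Real.tanh (x / Real.sqrt 2) ^ 3 / 3)
  have hs : 0 < Real.sqrt 2 := by positivity
  have htop : Tendsto E atTop (nhds (Real.sqrt 2 / 2 * (1 - 1 ^ 3 / 3))) := by
    have h := Real.tendsto_tanh_atTop_one.comp (tendsto_id.atTop_div_const hs)
    exact (h.sub ((h.pow 3).div_const 3)).const_mul _
  have hbot : Tendsto E atBot (nhds (Real.sqrt 2 / 2 * (-1 - (-1) ^ 3 / 3))) := by
    have h := Real.tendsto_tanh_atBot_neg_one.comp (tendsto_id.atBot_div_const hs)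
    exact (h.sub ((h.pow 3).div_const 3)).const_mul _
  let H : ℝ → EuclideanSpace ℝ (Fin N) :=
    fun x => G x - (p x • n + r x • n + (κ * E x) • n)
  have hderiv (x : ℝ) : HasDerivAt H 0 x := by
    have h := (hG x).hasDerivAt.sub
      ((((hp x).hasDerivAt.smul_const n).add ((hr x).hasDerivAt.smul_const n)).add
        (((hasDerivAt_tanh_profile_energy x).const_mul κ).smul_const n))
    rw [hODE x, sub_self] at h
    exact h
  have hconst (x : ℝ) : H x = H 0 :=
    is_const_of_deriv_eq_zero (fun x => (hderiv x).differentiableAt)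
      (fun x => (hderiv x).deriv) x 0
  have hT := hGp.sub (((hpp.smul_const n).add (hrtop.smul_const n)).add
    ((htop.const_mul κ).smul_const n))
  have hB := hGm.sub (((hpm.smul_const n).add (hrbot.smul_const n)).add
    ((hbot.const_mul κ).smul_const n))
  have h1 := tendsto_nhds_unique (hT.congr hconst) tendsto_const_nhds
  have h2 := tendsto_nhds_unique (hB.congr hconst) tendsto_const_nhds
  have h := h1.trans h2.symm
  rw [sub_eq_sub_iff_sub_eq_sub] at h
  rw [h]
  module
end

section
/- Let φ₀(ξ) = tanh(ξ/√2) and σ = (2/3)√2. Let ρ : ℝ → ℝ be continuous, bounded and positive, let V, u, κ ∈ ℝ, and let φ₁ : ℝ → ℝ be twice continuously differentiable with φ₁, φ₁' and φ₁'' bounded on ℝ. Suppose that for all ξ ∈ ℝ: −ρ(ξ)²·(V − u)·φ₀'(ξ) = κ·φ₀'(ξ) + φ₁''(ξ) − (3φ₀(ξ)² − 1)·φ₁(ξ). Then ξ ↦ ρ(ξ)²·φ₀'(ξ)² is integrable on ℝ and (V − u)·∫_{−∞}^{+∞} ρ(ξ)²·φ₀'(ξ)² dξ + σ·κ = 0.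 -/
open MeasureTheory

namespace Real

theorem hasDerivAt_tanh (x : ℝ) : HasDerivAt tanh (1 - tanh x ^ 2) x := by
  have hc : cosh x ≠ 0 := (cosh_pos x).ne'
  have h := (hasDerivAt_sinh x).div (hasDerivAt_cosh x) hc
  have hfun : tanh = sinh / cosh := funext tanh_eq_sinh_div_cosh
  rw [hfun]
  refine h.congr_deriv ?_
  rw [← hfun, tanh_eq_sinh_div_cosh]
  field_simp

theorem tendsto_tanh_atTop : Filter.Tendsto tanh Filter.atTop (nhds 1) := by
  have hexp : Filter.Tendsto (fun x : ℝ => exp (-(2 * x))) Filter.atTop (nhds 0) :=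
    tendsto_exp_neg_atTop_nhds_zero.comp
      (Filter.tendsto_id.const_mul_atTop (by norm_num : (0 : ℝ) < 2))
  have h := (hexp.const_sub 1).div (hexp.const_add 1) (by norm_num)
  simp only [sub_zero, add_zero, div_one] at h
  refine h.congr fun x => ?_
  have hx : exp (-(2 * x)) = exp (-x) * exp (-x) := by rw [← exp_add]; ring_nf
  have hinv : exp x * exp (-x) = 1 := by rw [← exp_add]; simp
  have h₁ := exp_pos x
  have h₂ := exp_pos (-x)
  simp only [Pi.div_apply, tanh_eq, hx]
  rw [div_eq_div_iff (by positivity) (by positivity)]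
  linear_combination (-2 * exp (-x)) * hinv

theorem tendsto_tanh_atBot : Filter.Tendsto tanh Filter.atBot (nhds (-1)) := by
  refine (tendsto_tanh_atTop.comp Filter.tendsto_neg_atBot_atTop).neg.congr fun x => ?_
  simp

end Real

/-- A bounded function on the line with continuous nonnegative derivative has integrable
derivative. -/
theorem integrable_of_hasDerivAt_of_nonneg_of_bounded {f f' : ℝ → ℝ} {C : ℝ}
    (hderiv : ∀ x, HasDerivAt f (f' x) x) (hcont : Continuous f') (hnonneg : ∀ x, 0 ≤ f' x)
    (hbound : ∀ x, |f x| ≤ C) : Integrable f' := by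
  refine integrable_of_intervalIntegral_norm_bounded (l := Filter.atTop)
    (a := fun x : ℝ => -x) (b := fun x : ℝ => x) (2 * C)
    (fun x => hcont.integrableOn_Ioc) Filter.tendsto_neg_atTop_atBot Filter.tendsto_id ?_
  refine Filter.Eventually.of_forall fun x => ?_
  simp only [Real.norm_of_nonneg (hnonneg _)]
  rw [intervalIntegral.integral_eq_sub_of_hasDerivAt (fun y _ => hderiv y)
    (hcont.intervalIntegrable _ _)]
  linarith [abs_le.mp (hbound x), abs_le.mp (hbound (-x))]

/-- Lemma 2.5 (case (C2) `M_ε = 1/ε`): the solvability condition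
`(V − u)·∫ρ²|φ₀'|² dξ + σκ = 0` relating the normal velocity deficit, the
density profile and the mean curvature. -/
theorem solvability_condition_C2
    (φ₀ : ℝ → ℝ) (hφ₀ : ∀ ξ : ℝ, φ₀ ξ = Real.tanh (ξ / Real.sqrt 2))
    (σ : ℝ) (hσ : σ = (2 / 3) * Real.sqrt 2)
    (ρ : ℝ → ℝ) (hρc : Continuous ρ) (hρb : ∃ C : ℝ, ∀ ξ : ℝ, |ρ ξ| ≤ C)
    (hρpos : ∀ ξ : ℝ, 0 < ρ ξ)
    (V u κ : ℝ)
    (φ₁ : ℝ → ℝ) (hφ₁ : ContDiff ℝ 2 φ₁)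
    (hb : ∃ C : ℝ, ∀ ξ : ℝ, |φ₁ ξ| ≤ C)
    (hb' : ∃ C : ℝ, ∀ ξ : ℝ, |deriv φ₁ ξ| ≤ C)
    (hb'' : ∃ C : ℝ, ∀ ξ : ℝ, |deriv (deriv φ₁) ξ| ≤ C)
    (heq : ∀ ξ : ℝ, -(ρ ξ ^ 2) * (V - u) * deriv φ₀ ξ
      = κ * deriv φ₀ ξ + deriv (deriv φ₁) ξ - (3 * φ₀ ξ ^ 2 - 1) * φ₁ ξ) :
    MeasureTheory.Integrable (fun ξ : ℝ => ρ ξ ^ 2 * (deriv φ₀ ξ) ^ 2) ∧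
    (V - u) * (∫ ξ : ℝ, ρ ξ ^ 2 * (deriv φ₀ ξ) ^ 2) + σ * κ = 0 := by
  obtain ⟨Cρ, hCρ⟩ := hρb
  obtain ⟨C, hC⟩ := hb
  obtain ⟨C', hC'⟩ := hb'
  have hs : Real.sqrt 2 ≠ 0 := by positivity
  have hs2 : Real.sqrt 2 ^ 2 = 2 := Real.sq_sqrt (by norm_num)
  have hd (x : ℝ) : HasDerivAt φ₀ ((1 - φ₀ x ^ 2) / Real.sqrt 2) x := by
    have h := (Real.hasDerivAt_tanh (x / Real.sqrt 2)).comp x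
      ((hasDerivAt_id x).div_const (Real.sqrt 2))
    rw [show φ₀ = Real.tanh ∘ fun y => y / Real.sqrt 2 from funext hφ₀]
    refine h.congr_deriv ?_
    simp [div_eq_mul_inv]
  have hderiv (x : ℝ) : deriv φ₀ x = (1 - φ₀ x ^ 2) / Real.sqrt 2 := (hd x).deriv
  have hφ₀_cont : Continuous φ₀ :=
    continuous_iff_continuousAt.mpr fun x => (hd x).continuousAt
  have hp_cont : Continuous (deriv φ₀) := by
    rw [funext hderiv]
    fun_prop
  have hφ₀_bound (x : ℝ) : |φ₀ x| ≤ 1 := by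
    rw [hφ₀]
    exact (Real.abs_tanh_lt_one _).le
  have hφ₀_sq (x : ℝ) : φ₀ x ^ 2 ≤ 1 := (sq_le_one_iff_abs_le_one _).mpr (hφ₀_bound x)
  have hp_nonneg (x : ℝ) : 0 ≤ deriv φ₀ x := by
    rw [hderiv]
    exact div_nonneg (by linarith [hφ₀_sq x]) (Real.sqrt_nonneg 2)
  have hp_le (x : ℝ) : deriv φ₀ x ≤ 1 := by
    rw [hderiv, div_le_one (by positivity)]
    have : 1 ≤ Real.sqrt 2 := Real.one_le_sqrt.mpr (by norm_num)
    linarith [sq_nonneg (φ₀ x)]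
  have hp_int : Integrable (deriv φ₀) :=
    integrable_of_hasDerivAt_of_nonneg_of_bounded
      (fun x => (hd x).differentiableAt.hasDerivAt) hp_cont hp_nonneg hφ₀_bound
  have hp2_int : Integrable (fun x => deriv φ₀ x ^ 2) := by
    refine hp_int.mono' (by fun_prop) (Filter.Eventually.of_forall fun x => ?_)
    rw [Real.norm_of_nonneg (sq_nonneg _)]
    nlinarith [hp_nonneg x, hp_le x]
  have hρp_int : Integrable (fun x => ρ x ^ 2 * deriv φ₀ x ^ 2) := by
    refine (hp2_int.const_mul (Cρ ^ 2)).mono' (by fun_prop)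
      (Filter.Eventually.of_forall fun x => ?_)
    rw [Real.norm_of_nonneg (by positivity)]
    have : ρ x ^ 2 ≤ Cρ ^ 2 :=
      pow_le_pow_left₀ (hρpos x).le ((le_abs_self _).trans (hCρ x)) 2
    gcongr
  refine ⟨hρp_int, ?_⟩
  have hφ₀_top : Filter.Tendsto φ₀ Filter.atTop (nhds 1) := by
    rw [funext hφ₀]
    exact Real.tendsto_tanh_atTop.comp (Filter.tendsto_id.atTop_div_const (by positivity))
  have hφ₀_bot : Filter.Tendsto φ₀ Filter.atBot (nhds (-1)) := by
    rw [funext hφ₀]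
    exact Real.tendsto_tanh_atBot.comp (Filter.tendsto_id.atBot_div_const (by positivity))
  have hσ_int : ∫ x, deriv φ₀ x ^ 2 = σ := by
    have hF (x : ℝ) : HasDerivAt (fun y => (φ₀ y - φ₀ y ^ 3 / 3) / Real.sqrt 2)
        (deriv φ₀ x ^ 2) x := by
      refine HasDerivAt.congr_deriv
        (((hd x).sub (((hd x).pow 3).div_const 3)).div_const (Real.sqrt 2)) ?_
      rw [hderiv]
      field_simp
      ring
    rw [integral_of_hasDerivAt_of_tendsto hF hp2_int
      ((hφ₀_bot.sub ((hφ₀_bot.pow 3).div_const 3)).div_const _)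
      ((hφ₀_top.sub ((hφ₀_top.pow 3).div_const 3)).div_const _), hσ]
    field_simp
    rw [hs2]
    norm_num
  have hd2 (x : ℝ) : HasDerivAt (deriv φ₀) (-φ₀ x * (1 - φ₀ x ^ 2)) x := by
    rw [funext hderiv]
    refine HasDerivAt.congr_deriv ((((hd x).pow 2).const_sub 1).div_const (Real.sqrt 2)) ?_
    field_simp
    rw [hs2]
    push_cast
    ring
  have hd3 (x : ℝ) : HasDerivAt (fun y => -φ₀ y * (1 - φ₀ y ^ 2))
      ((3 * φ₀ x ^ 2 - 1) * deriv φ₀ x) x := by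
    refine HasDerivAt.congr_deriv ((hd x).neg.mul (((hd x).pow 2).const_sub 1)) ?_
    rw [hderiv]
    simp only [Pi.neg_apply]
    field_simp
    push_cast
    ring
  have hφ₁_d (x : ℝ) : HasDerivAt φ₁ (deriv φ₁ x) x :=
    (hφ₁.differentiable (by norm_num) x).hasDerivAt
  have hφ₁_d2 (x : ℝ) : HasDerivAt (deriv φ₁) (deriv (deriv φ₁) x) x := by
    have h : ContDiff ℝ 1 (deriv φ₁) := hφ₁.deriv'
    exact (h.differentiable (by norm_num) x).hasDerivAt
  have hW (x : ℝ) : HasDerivAt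
      (fun y => deriv φ₁ y * deriv φ₀ y - φ₁ y * (-φ₀ y * (1 - φ₀ y ^ 2)))
      (-(V - u) * (ρ x ^ 2 * deriv φ₀ x ^ 2) + -κ * deriv φ₀ x ^ 2) x := by
    refine HasDerivAt.congr_deriv (((hφ₁_d2 x).mul (hd2 x)).sub ((hφ₁_d x).mul (hd3 x))) ?_
    linear_combination -deriv φ₀ x * heq x
  have hW_lim {l : Filter ℝ} {a : ℝ} (ha : a ^ 2 = 1) (h : Filter.Tendsto φ₀ l (nhds a)) :
      Filter.Tendsto (fun y => deriv φ₁ y * deriv φ₀ y - φ₁ y * (-φ₀ y * (1 - φ₀ y ^ 2)))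
        l (nhds 0) := by
    have hp : Filter.Tendsto (deriv φ₀) l (nhds 0) := by
      rw [funext hderiv]
      simpa [ha] using ((h.pow 2).const_sub 1).div_const (Real.sqrt 2)
    have hp' : Filter.Tendsto (fun y => -φ₀ y * (1 - φ₀ y ^ 2)) l (nhds 0) := by
      simpa [ha] using h.neg.mul ((h.pow 2).const_sub 1)
    simpa using (bdd_le_mul_tendsto_zero' C' (Filter.Eventually.of_forall hC') hp).sub
      (bdd_le_mul_tendsto_zero' C (Filter.Eventually.of_forall hC) hp')
  have key := integral_of_hasDerivAt_of_tendsto hW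
    ((hρp_int.const_mul _).add (hp2_int.const_mul _))
    (hW_lim (by norm_num) hφ₀_bot) (hW_lim (by norm_num) hφ₀_top)
  rw [integral_add (hρp_int.const_mul _) (hp2_int.const_mul _), integral_const_mul,
    integral_const_mul, hσ_int] at key
  linarith
end
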